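/- Let X be a real random variable with Gaussian distribution N(m, s²), s > 0, let a < b be censoring limits, and set a* = (a − m)/s, b* = (b − m)/s, and P = Φ(b*) − Φ(a*). Then the third moment of the censored variable satisfies E[(clip_{a,b}(X))³] = (m³ + 3ms²)·P + a³·Φ(a*) + b³·(1 − Φ(b*)) + (2s³ + 3m²s)·(φ(a*) − φ(b*)) + 3ms²·(a*·φ(a*) − b*·φ(b*)) + s³·(a*²·φ(a*) − b*²·φ(b*)). -/

import Mathlib

open MeasureTheory ProbabilityTheory Real

/-- The standard normal cumulative distribution function Φ. -/
noncomputable def stdNormalCDF (x : ℝ) : ℝ :=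
  ((gaussianReal 0 1) (Set.Iic x)).toReal

/-- The standard normal probability density function φ. -/
noncomputable def stdNormalPDF (x : ℝ) : ℝ :=
  gaussianPDFReal 0 1 x

/-- The censoring (clipping) map: `clip a b x = x` if `a < x < b`,
`= a` if `x ≤ a`, `= b` if `x ≥ b` (for `a < b`). -/
noncomputable def clip (a b x : ℝ) : ℝ := max a (min b x)

theorem continuous_clip (a b : ℝ) : Continuous (clip a b) := by
  unfold clip
  fun_prop

theorem abs_clip_le (a b x : ℝ) : |clip a b x| ≤ max |a| |b| + |a| := by
  have h₁ : min a b ≤ clip a b x := (min_le_left _ _).trans (le_max_left _ _)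
  have h₂ : clip a b x ≤ max a b := max_le_max le_rfl (min_le_left _ _)
  rw [abs_le]
  have := neg_abs_le a
  have := neg_abs_le b
  have := le_abs_self a
  have := le_abs_self b
  have := le_max_left |a| |b|
  have := le_max_right |a| |b|
  have := abs_nonneg a
  constructor
  · rcases min_choice a b with h | h <;> linarith
  · rcases max_choice a b with h | h <;> linarith

theorem integrable_clip_pow {Ω : Type*} [MeasurableSpace Ω] (μ : Measure Ω) [IsFiniteMeasure μ]
    (a b : ℝ) (n : ℕ) {X : Ω → ℝ} (hX : Measurable X) :
    Integrable (fun ω => clip a b (X ω) ^ n) μ := by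
  refine Integrable.of_bound
    (((continuous_clip a b).pow n).measurable.comp hX).aestronglyMeasurable
    ((max |a| |b| + |a|) ^ n) (Filter.Eventually.of_forall fun ω => ?_)
  rw [norm_pow, Real.norm_eq_abs]
  gcongr
  exact abs_clip_le a b (X ω)

theorem continuous_stdNormalPDF : Continuous stdNormalPDF := by
  unfold stdNormalPDF gaussianPDFReal
  fun_prop

theorem hasDerivAt_stdNormalPDF (x : ℝ) : HasDerivAt stdNormalPDF (-x * stdNormalPDF x) x := by
  have h : HasDerivAt (fun y : ℝ => -(y - 0) ^ 2 / (2 * ((1 : NNReal) : ℝ))) (-x) x := by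
    refine ((((hasDerivAt_id x).sub_const 0).pow 2).neg.div_const
      (2 * ((1 : NNReal) : ℝ))).congr_deriv ?_
    simp
    ring
  refine (h.exp.const_mul (√(2 * π * ((1 : NNReal) : ℝ)))⁻¹).congr_deriv ?_
  simp only [stdNormalPDF, gaussianPDFReal]
  ring

theorem stdNormal_real_Ioc {α β : ℝ} (h : α ≤ β) :
    (gaussianReal 0 1).real (Set.Ioc α β) = stdNormalCDF β - stdNormalCDF α := by
  rw [← Set.Iic_sdiff_Iic, measureReal_sdiff (Set.Iic_subset_Iic.2 h) measurableSet_Iic]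
  rfl

theorem stdNormal_real_Ioi (β : ℝ) :
    (gaussianReal 0 1).real (Set.Ioi β) = 1 - stdNormalCDF β := by
  rw [← Set.compl_Iic, probReal_compl_eq_one_sub measurableSet_Iic]
  rfl

theorem setIntegral_Ioc_stdNormal (f : ℝ → ℝ) {α β : ℝ} (h : α ≤ β) :
    ∫ z in Set.Ioc α β, f z ∂gaussianReal 0 1 = ∫ z in α..β, stdNormalPDF z * f z := by
  rw [intervalIntegral.integral_of_le h, ← integral_indicator measurableSet_Ioc,
    integral_gaussianReal_eq_integral_smul one_ne_zero, ← integral_indicator measurableSet_Ioc]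
  congr 1 with z
  by_cases hz : z ∈ Set.Ioc α β <;> simp [hz, stdNormalPDF]

theorem setIntegral_Ioc_stdNormal_affine_cube (m s : ℝ) {α β : ℝ} (h : α ≤ β) :
    ∫ z in Set.Ioc α β, (s * z + m) ^ 3 ∂gaussianReal 0 1 =
      (m ^ 3 + 3 * m * s ^ 2) * (stdNormalCDF β - stdNormalCDF α)
        + (2 * s ^ 3 + 3 * m ^ 2 * s) * (stdNormalPDF α - stdNormalPDF β)
        + 3 * m * s ^ 2 * (α * stdNormalPDF α - β * stdNormalPDF β)
        + s ^ 3 * (α ^ 2 * stdNormalPDF α - β ^ 2 * stdNormalPDF β) := by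
  have hφ := continuous_stdNormalPDF
  have hcdf : stdNormalCDF β - stdNormalCDF α = ∫ z in α..β, stdNormalPDF z := by
    simpa [stdNormal_real_Ioc h] using setIntegral_Ioc_stdNormal (fun _ => 1) h
  have hderiv (z : ℝ) : HasDerivAt
      (fun z => -((2 * s ^ 3 + 3 * m ^ 2 * s + 3 * m * s ^ 2 * z + s ^ 3 * z ^ 2)
        * stdNormalPDF z))
      (stdNormalPDF z * (s * z + m) ^ 3 - (m ^ 3 + 3 * m * s ^ 2) * stdNormalPDF z) z := by
    have hp := ((((hasDerivAt_id z).const_mul (3 * m * s ^ 2)).const_add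
      (2 * s ^ 3 + 3 * m ^ 2 * s)).add (((hasDerivAt_id z).pow 2).const_mul (s ^ 3)))
    refine (hp.mul (hasDerivAt_stdNormalPDF z)).neg.congr_deriv ?_
    simp
    ring
  have hftc := intervalIntegral.integral_eq_sub_of_hasDerivAt (a := α) (b := β)
    (fun z _ => hderiv z) (Continuous.intervalIntegrable (by fun_prop) _ _)
  rw [intervalIntegral.integral_sub (Continuous.intervalIntegrable (by fun_prop) _ _)
    (Continuous.intervalIntegrable (by fun_prop) _ _), intervalIntegral.integral_const_mul,
    ← hcdf] at hftc
  rw [setIntegral_Ioc_stdNormal _ h]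
  linear_combination hftc

theorem gaussianReal_eq_map_stdNormal (m : ℝ) (s : ℝ) :
    gaussianReal m (s ^ 2).toNNReal = (gaussianReal 0 1).map (fun z => s * z + m) := by
  have h : (fun z : ℝ => s * z + m) = (fun z => z + m) ∘ (fun z => s * z) := rfl
  rw [h, ← Measure.map_map (by fun_prop) (by fun_prop), gaussianReal_map_const_mul,
    gaussianReal_map_add_const]
  congr 1
  · simp
  · ext
    simp [sq_nonneg]

theorem censored_third_moment {Ω : Type*} [MeasureSpace Ω]
    [IsProbabilityMeasure (ℙ : Measure Ω)]
    (X : Ω → ℝ) (hXm : Measurable X) (m s a b : ℝ) (hs : 0 < s) (hab : a < b)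
    (hX : Measure.map X ℙ = gaussianReal m ((s ^ 2).toNNReal)) :
    ∫ ω, (clip a b (X ω)) ^ 3 ∂ℙ =
      (m ^ 3 + 3 * m * s ^ 2) * (stdNormalCDF ((b - m) / s) - stdNormalCDF ((a - m) / s))
        + a ^ 3 * stdNormalCDF ((a - m) / s) + b ^ 3 * (1 - stdNormalCDF ((b - m) / s))
        + (2 * s ^ 3 + 3 * m ^ 2 * s) * (stdNormalPDF ((a - m) / s) - stdNormalPDF ((b - m) / s))
        + 3 * m * s ^ 2 * ((a - m) / s * stdNormalPDF ((a - m) / s)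
            - (b - m) / s * stdNormalPDF ((b - m) / s))
        + s ^ 3 * (((a - m) / s) ^ 2 * stdNormalPDF ((a - m) / s)
            - ((b - m) / s) ^ 2 * stdNormalPDF ((b - m) / s)) := by
  have hα : ∀ z, z ≤ (a - m) / s ↔ s * z + m ≤ a := fun z => by
    rw [le_div_iff₀ hs, le_sub_iff_add_le, mul_comm]
  have hβ : ∀ z, z ≤ (b - m) / s ↔ s * z + m ≤ b := fun z => by
    rw [le_div_iff₀ hs, le_sub_iff_add_le, mul_comm]
  have hαβ : (a - m) / s ≤ (b - m) / s := by gcongr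
  generalize (a - m) / s = α at *
  generalize (b - m) / s = β at *
  have hmeas : Measurable fun z : ℝ => s * z + m := by fun_prop
  have hclip := integrable_clip_pow (gaussianReal 0 1) a b 3 hmeas
  have hlaw : ∫ ω, clip a b (X ω) ^ 3 ∂ℙ = ∫ z, clip a b (s * z + m) ^ 3 ∂gaussianReal 0 1 := by
    have hcont : Continuous fun x => clip a b x ^ 3 := (continuous_clip a b).pow 3
    rw [← integral_map (φ := X) (f := fun x => clip a b x ^ 3) hXm.aemeasurable hcont.aestronglyMeasurable, hX,
      gaussianReal_eq_map_stdNormal,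
      integral_map (φ := fun z => s * z + m) hmeas.aemeasurable hcont.aestronglyMeasurable]
  have hlow : ∫ z in Set.Iic α, clip a b (s * z + m) ^ 3 ∂gaussianReal 0 1
      = a ^ 3 * stdNormalCDF α := by
    rw [setIntegral_congr_fun (g := fun _ => a ^ 3) measurableSet_Iic fun z hz => ?_]
    · simp [stdNormalCDF, Measure.real, mul_comm]
    · simp [clip, (hα z).1 hz]
  have hmid : ∫ z in Set.Ioc α β, clip a b (s * z + m) ^ 3 ∂gaussianReal 0 1
      = ∫ z in Set.Ioc α β, (s * z + m) ^ 3 ∂gaussianReal 0 1 := by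
    refine setIntegral_congr_fun measurableSet_Ioc fun z hz => ?_
    have hza : a ≤ s * z + m := (not_le.1 fun h => hz.1.not_ge ((hα z).2 h)).le
    simp [clip, (hβ z).1 hz.2, hza]
  have hhigh : ∫ z in Set.Ioi β, clip a b (s * z + m) ^ 3 ∂gaussianReal 0 1
      = b ^ 3 * (1 - stdNormalCDF β) := by
    rw [setIntegral_congr_fun (g := fun _ => b ^ 3) measurableSet_Ioi fun z hz => ?_]
    · simp [stdNormal_real_Ioi, mul_comm]
    · have hzb : b ≤ s * z + m := (not_le.1 fun h => (Set.mem_Ioi.1 hz).not_ge ((hβ z).2 h)).le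
      simp [clip, hzb, hab.le]
  have hsplit : ∫ z in Set.Ioi α, clip a b (s * z + m) ^ 3 ∂gaussianReal 0 1
      = (∫ z in Set.Ioc α β, clip a b (s * z + m) ^ 3 ∂gaussianReal 0 1)
        + ∫ z in Set.Ioi β, clip a b (s * z + m) ^ 3 ∂gaussianReal 0 1 := by
    rw [← Set.Ioc_union_Ioi_eq_Ioi hαβ, setIntegral_union Set.Ioc_disjoint_Ioi_same
      measurableSet_Ioi hclip.integrableOn hclip.integrableOn]
  rw [hlaw, ← integral_add_compl measurableSet_Iic hclip, Set.compl_Iic, hsplit, hlow, hmid, hhigh,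
    setIntegral_Ioc_stdNormal_affine_cube m s hαβ]
  ring
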